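/- arXiv:1907.10743 — 2 statements merged into one kernel-verified Lean document; each statement's English description precedes it below -/
import Mathlib

section
/- Let d≥1, let U⊆ℝ^{d+1} be open, and let g:U→{invertible symmetric (d+1)×(d+1) real matrices} be C² with det g<0 on U. Let 𝒜 be a finite set, and for each A∈𝒜 let F_A∈C¹(U;ℝ) be compactly supported and u_A∈C²(U;ℝ). Assume for every A∈𝒜: (i) (g⁻¹)^{αβ}(∂_αu_A)(∂_βu_A)=0 on U and du_A never vanishes; (ii) 2(g⁻¹)^{αβ}(∂_βu_A)(∂_αF_A) + (□_g u_A)·F_A = 0 on U. Then for every a∈C_c^∞(U×ℝ^{d+1};ℝ), Σ_{A∈𝒜} ∫_U [(g⁻¹)^{αβ}(x)(∂_βu_A)(x)·(∂_{x^α}a)(x,du_A(x)) − ½(∂_{x^σ}(g⁻¹)^{αβ})(x)(∂_αu_A)(x)(∂_βu_A)(x)·(∂_{ξ_σ}a)(x,du_A(x))]·F_A(x)²·√(−det g(x)) dx = 0. (This says that μ = Σ_A F_A² δ_{ξ=du_A} dVol_g is a measure solution of the massless Vlasov equation on (U,g): a null-dust solution induces a measure Vlasov solution.) -/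
open MeasureTheory Real Filter
open scoped ENNReal

noncomputable section

/-- Partial derivative in coordinate direction `α` on `ℝ^{d+1}`. -/
noncomputable def pdN (d : ℕ) (α : Fin (d + 1)) (f : (Fin (d + 1) → ℝ) → ℝ)
    (x : Fin (d + 1) → ℝ) : ℝ :=
  fderiv ℝ f x (Pi.single α 1)

/-- Wave operator of a matrix-valued Lorentzian metric:
`□_g φ = (−det g)^{−1/2} ∂_α ((g⁻¹)^{αβ}(−det g)^{1/2} ∂_β φ)`. -/
noncomputable def boxN (d : ℕ) (g : (Fin (d + 1) → ℝ) → Matrix (Fin (d + 1)) (Fin (d + 1)) ℝ)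
    (φ : (Fin (d + 1) → ℝ) → ℝ) (x : Fin (d + 1) → ℝ) : ℝ :=
  (Real.sqrt (-(g x).det))⁻¹ *
    ∑ α, pdN d α (fun y => ∑ β, (g y)⁻¹ α β * Real.sqrt (-(g y).det) * pdN d β φ y) x

theorem pdN_sum {d : ℕ} {κ : Type*} (s : Finset κ) (α : Fin (d + 1))
    {f : κ → (Fin (d + 1) → ℝ) → ℝ} {x : Fin (d + 1) → ℝ}
    (hf : ∀ i ∈ s, DifferentiableAt ℝ (f i) x) :
    pdN d α (fun y => ∑ i ∈ s, f i y) x = ∑ i ∈ s, pdN d α (f i) x := by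
  unfold pdN
  rw [fderiv_fun_sum hf]
  simp

theorem pdN_mul {d : ℕ} (α : Fin (d + 1)) {f h : (Fin (d + 1) → ℝ) → ℝ} {x : Fin (d + 1) → ℝ}
    (hf : DifferentiableAt ℝ f x) (hh : DifferentiableAt ℝ h x) :
    pdN d α (fun y => f y * h y) x = pdN d α f x * h x + f x * pdN d α h x := by
  unfold pdN
  rw [fderiv_fun_mul hf hh]
  simp
  ring

theorem ContDiffOn.pdN {d : ℕ} {n m : WithTop ℕ∞} {f : (Fin (d + 1) → ℝ) → ℝ}
    {U : Set (Fin (d + 1) → ℝ)} (hf : ContDiffOn ℝ n f U) (hU : IsOpen U) (hmn : m + 1 ≤ n)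
    (α : Fin (d + 1)) : ContDiffOn ℝ m (pdN d α f) U :=
  (hf.fderiv_of_isOpen hU hmn).clm_apply contDiffOn_const

theorem pdN_comm {d : ℕ} {f : (Fin (d + 1) → ℝ) → ℝ} {x : Fin (d + 1) → ℝ}
    (hf : ContDiffAt ℝ 2 f x) (α β : Fin (d + 1)) :
    pdN d α (pdN d β f) x = pdN d β (pdN d α f) x := by
  have hd : DifferentiableAt ℝ (fderiv ℝ f) x :=
    (hf.fderiv_right (m := 1) (by norm_num)).differentiableAt (by norm_num)
  have key : ∀ γ δ : Fin (d + 1), pdN d γ (pdN d δ f) x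
      = fderiv ℝ (fderiv ℝ f) x (Pi.single γ 1) (Pi.single δ 1) := by
    intro γ δ
    change fderiv ℝ (fun y => fderiv ℝ f y (Pi.single δ 1)) x (Pi.single γ 1) = _
    rw [fderiv_clm_apply hd (differentiableAt_const _)]
    simp
  rw [key, key]
  exact hf.isSymmSndFDerivAt (by simp) _ _

/-- Chain rule for a function of position and momentum evaluated along a section. -/
theorem pdN_comp_section {d : ℕ} {a : (Fin (d + 1) → ℝ) → (Fin (d + 1) → ℝ) → ℝ}
    {P : Fin (d + 1) → (Fin (d + 1) → ℝ) → ℝ} {x : Fin (d + 1) → ℝ}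
    (ha : DifferentiableAt ℝ
      (fun p : (Fin (d + 1) → ℝ) × (Fin (d + 1) → ℝ) => a p.1 p.2) (x, fun μ => P μ x))
    (hP : ∀ μ, DifferentiableAt ℝ (P μ) x) (α : Fin (d + 1)) :
    pdN d α (fun y => a y (fun μ => P μ y)) x
      = pdN d α (fun y => a y (fun μ => P μ x)) x
        + ∑ σ, pdN d σ (fun ξ => a x ξ) (fun μ => P μ x) * pdN d α (P σ) x := by
  set L := fderiv ℝ (fun p : (Fin (d + 1) → ℝ) × (Fin (d + 1) → ℝ) => a p.1 p.2)
    (x, fun μ => P μ x)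
  have hL : HasFDerivAt (fun p : (Fin (d + 1) → ℝ) × (Fin (d + 1) → ℝ) => a p.1 p.2) L
    (x, fun μ => P μ x) := ha.hasFDerivAt
  have hS : HasFDerivAt (fun y => fun μ => P μ y)
      (ContinuousLinearMap.pi fun μ => fderiv ℝ (P μ) x) x :=
    hasFDerivAt_pi.2 fun μ => (hP μ).hasFDerivAt
  have h1 : HasFDerivAt (fun y => a y (fun μ => P μ y)) _ x :=
    HasFDerivAt.comp (f := fun y => (y, fun μ => P μ y)) x hL ((hasFDerivAt_id x).prodMk hS)
  have h2 : HasFDerivAt (fun y => a y (fun μ => P μ x)) _ x :=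
    HasFDerivAt.comp (f := fun y => (y, fun μ => P μ x)) x hL
      ((hasFDerivAt_id x).prodMk (hasFDerivAt_const _ x))
  have h3 : HasFDerivAt (fun ξ => a x ξ) _ (fun μ => P μ x) :=
    HasFDerivAt.comp (f := fun ξ => (x, ξ)) (fun μ => P μ x) hL
      ((hasFDerivAt_const _ _).prodMk (hasFDerivAt_id _))
  unfold pdN
  rw [h1.fderiv, h2.fderiv, h3.fderiv]
  simp only [ContinuousLinearMap.comp_apply, ContinuousLinearMap.prod_apply,
    ContinuousLinearMap.id_apply, zero_apply]
  set w : Fin (d + 1) → ℝ := fun μ => fderiv ℝ (P μ) x (Pi.single α 1)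
  have hpi : (ContinuousLinearMap.pi fun μ => fderiv ℝ (P μ) x) (Pi.single α 1) = w := rfl
  have hsum : ∀ v : Fin (d + 1) → ℝ, L (0, v) = ∑ σ, L (0, Pi.single σ 1) * v σ := by
    intro v
    have hv : ((0 : Fin (d + 1) → ℝ), v)
        = ∑ σ, v σ • ((0 : Fin (d + 1) → ℝ), (Pi.single σ 1 : Fin (d + 1) → ℝ)) := by
      refine Prod.ext ?_ ?_
      · simp [Prod.fst_sum]
      · simp only [Prod.snd_sum, Prod.smul_snd]
        exact pi_eq_sum_univ' v
    rw [hv, map_sum]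
    exact Finset.sum_congr rfl fun σ _ => by rw [map_smul, smul_eq_mul, mul_comm]
  rw [hpi, ← hsum w, ← map_add]
  simp

theorem contDiffOn_matrix_det {E κ : Type*} [NormedAddCommGroup E] [NormedSpace ℝ E]
    [Fintype κ] [DecidableEq κ] {n : WithTop ℕ∞} {s : Set E} {M : E → Matrix κ κ ℝ}
    (hM : ∀ i j, ContDiffOn ℝ n (fun x => M x i j) s) :
    ContDiffOn ℝ n (fun x => (M x).det) s := by
  simp only [Matrix.det_apply']
  exact ContDiffOn.sum fun τ _ => contDiffOn_const.mul (contDiffOn_prod fun i _ => hM _ _)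

theorem contDiffOn_matrix_inv {E κ : Type*} [NormedAddCommGroup E] [NormedSpace ℝ E]
    [Fintype κ] [DecidableEq κ] {n : WithTop ℕ∞} {s : Set E} {M : E → Matrix κ κ ℝ}
    (hM : ∀ i j, ContDiffOn ℝ n (fun x => M x i j) s) (hdet : ∀ x ∈ s, (M x).det ≠ 0)
    (i j : κ) : ContDiffOn ℝ n (fun x => (M x)⁻¹ i j) s := by
  simp only [Matrix.inv_def, Matrix.smul_apply, Ring.inverse_eq_inv', smul_eq_mul,
    Matrix.adjugate_apply]
  refine ((contDiffOn_matrix_det hM).inv hdet).mul (contDiffOn_matrix_det fun k l => ?_)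
  by_cases hk : k = j
  · subst hk
    simpa using contDiffOn_const
  · simpa [Matrix.updateRow_ne hk] using hM k l

theorem integral_pdN_eq_zero {d : ℕ} {f : (Fin (d + 1) → ℝ) → ℝ} (hf : ContDiff ℝ 1 f)
    (hs : HasCompactSupport f) (α : Fin (d + 1)) : ∫ x, pdN d α f x = 0 := by
  have h := integral_mul_fderiv_eq_neg_fderiv_mul_of_integrable
    (μ := (volume : Measure (Fin (d + 1) → ℝ))) (f := fun _ => (1 : ℝ)) (g := f)
    (v := Pi.single α 1) (by simp)
    (by
      simpa using (((hf.continuous_fderiv (by norm_num)).clm_apply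
        continuous_const).integrable_of_hasCompactSupport (hs.fderiv_apply ℝ _)))
    (by simpa using hf.continuous.integrable_of_hasCompactSupport hs)
    (fun _ _ => differentiableAt_const _)
    (fun _ _ => hf.differentiable (by norm_num) _)
  simpa [pdN] using h

theorem integrable_pdN {d : ℕ} {f : (Fin (d + 1) → ℝ) → ℝ} (hf : ContDiff ℝ 1 f)
    (hs : HasCompactSupport f) (α : Fin (d + 1)) : Integrable (pdN d α f) :=
  ((hf.continuous_fderiv (by norm_num)).clm_apply
    continuous_const).integrable_of_hasCompactSupport (hs.fderiv_apply ℝ _)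

/-- Divergence theorem for a `C¹` field on an open set with support compactly contained in it. -/
theorem setIntegral_divergence_eq_zero {d : ℕ} {U K : Set (Fin (d + 1) → ℝ)} (hU : IsOpen U)
    (hK : IsCompact K) (hKU : K ⊆ U) {H : Fin (d + 1) → (Fin (d + 1) → ℝ) → ℝ}
    (hH : ∀ α, ContDiffOn ℝ 1 (H α) U) (h0 : ∀ α, ∀ x ∉ K, H α x = 0) :
    ∫ x in U, ∑ α, pdN d α (H α) x = 0 := by
  have hev : ∀ α, ∀ x ∉ K, H α =ᶠ[nhds x] fun _ => 0 := fun α x hx =>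
    Filter.eventually_of_mem (hK.isClosed.isOpen_compl.mem_nhds hx) fun y hy => h0 α y hy
  have hC : ∀ α, ContDiff ℝ 1 (H α) := by
    intro α
    rw [contDiff_iff_contDiffAt]
    intro x
    by_cases hx : x ∈ K
    · exact (hH α).contDiffAt (hU.mem_nhds (hKU hx))
    · exact contDiffAt_const.congr_of_eventuallyEq (hev α x hx)
  have hS : ∀ α, HasCompactSupport (H α) := fun α =>
    HasCompactSupport.intro hK (h0 α)
  rw [setIntegral_eq_integral_of_forall_compl_eq_zero, integral_finsetSum]
  · exact Finset.sum_eq_zero fun α _ => integral_pdN_eq_zero (hC α) (hS α) α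
  · exact fun α _ => integrable_pdN (hC α) (hS α) α
  · intro x hx
    refine Finset.sum_eq_zero fun α _ => ?_
    unfold pdN
    rw [(hev α x fun h => hx (hKU h)).fderiv_eq]
    simp

/-- If `G^{αβ} P_α P_β` is constant to first order and `Q` is symmetric, the derivative of `a`
along the section with momentum `P` is its derivative along the geodesic flow. -/
theorem sum_transport_eq {κ : Type*} [Fintype κ] (G Q : κ → κ → ℝ) (P A B : κ → ℝ)
    (DG : κ → κ → κ → ℝ) (hG : ∀ α β, G α β = G β α) (hQ : ∀ α β, Q α β = Q β α)
    (h : ∀ σ, ∑ α, ∑ β, (DG σ α β * P α * P β + G α β * Q σ α * P β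
      + G α β * P α * Q σ β) = 0) :
    ∑ α, ∑ β, G α β * P β * (A α + ∑ σ, B σ * Q α σ)
      = ∑ α, ∑ β, G α β * P β * A α
        - (1 / 2) * ∑ σ, ∑ α, ∑ β, DG σ α β * P α * P β * B σ := by
  have h1 : ∀ σ, ∑ α, ∑ β, DG σ α β * P α * P β
      = -2 * ∑ α, ∑ β, G α β * P β * Q α σ := by
    intro σ
    have e1 : ∑ α, ∑ β, G α β * Q σ α * P β = ∑ α, ∑ β, G α β * P β * Q α σ :=
      Finset.sum_congr rfl fun α _ => Finset.sum_congr rfl fun β _ => by rw [hQ σ α]; ring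
    have e2 : ∑ α, ∑ β, G α β * P α * Q σ β = ∑ α, ∑ β, G α β * P β * Q α σ := by
      rw [Finset.sum_comm]
      exact Finset.sum_congr rfl fun α _ => Finset.sum_congr rfl fun β _ => by
        rw [hQ σ α, hG β α]
    have := h σ
    simp only [Finset.sum_add_distrib] at this
    rw [e1, e2] at this
    linarith
  have h2 : ∑ σ, ∑ α, ∑ β, DG σ α β * P α * P β * B σ
      = -2 * ∑ σ, ∑ α, ∑ β, G α β * P β * (B σ * Q α σ) := by
    rw [Finset.mul_sum]
    refine Finset.sum_congr rfl fun σ _ => ?_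
    have e : ∑ α, ∑ β, DG σ α β * P α * P β * B σ
        = (∑ α, ∑ β, DG σ α β * P α * P β) * B σ := by simp only [Finset.sum_mul]
    rw [e, h1]
    simp only [Finset.mul_sum, Finset.sum_mul]
    exact Finset.sum_congr rfl fun α _ => Finset.sum_congr rfl fun β _ => by ring
  have h3 : ∑ α, ∑ β, G α β * P β * ∑ σ, B σ * Q α σ
      = ∑ σ, ∑ α, ∑ β, G α β * P β * (B σ * Q α σ) := by
    rw [Finset.sum_comm]
    simp only [Finset.mul_sum]
    rw [Finset.sum_comm]
    conv_rhs => rw [Finset.sum_comm]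
    refine Finset.sum_congr rfl fun α _ => ?_
    rw [Finset.sum_comm]
  simp only [mul_add, Finset.sum_add_distrib]
  rw [h3, h2]
  ring

/-- null dust induces a measure solution of the massless Vlasov equation:
if `{(F_A, u_A)}` is a compactly supported solution of the null dust system on `(U, g)`, then
the measure `μ = Σ_A F_A² δ_{ξ = du_A} dVol_g` satisfies the transport equation of the massless
Vlasov system, i.e. testing against any `a ∈ C_c^∞(U × ℝ^{d+1})` gives zero. -/
theorem stmt2
    (d : ℕ) (hd : 1 ≤ d)
    (U : Set (Fin (d + 1) → ℝ)) (hU : IsOpen U)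
    (g : (Fin (d + 1) → ℝ) → Matrix (Fin (d + 1)) (Fin (d + 1)) ℝ)
    (hgC2 : ∀ α β', ContDiffOn ℝ 2 (fun x => g x α β') U)
    (hgsymm : ∀ x ∈ U, (g x).IsSymm)
    (hgdet : ∀ x ∈ U, (g x).det < 0)
    (ι : Type) [Fintype ι]
    (F u : ι → (Fin (d + 1) → ℝ) → ℝ)
    (hFreg : ∀ A, ContDiffOn ℝ 1 (F A) U)
    (hFsupp : ∀ A, HasCompactSupport (F A) ∧ tsupport (F A) ⊆ U)
    (hureg : ∀ A, ContDiffOn ℝ 2 (u A) U)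
    -- (i) the eikonal equation, with non-vanishing differential
    (heik : ∀ A, ∀ x ∈ U,
      (∑ α, ∑ β', (g x)⁻¹ α β' * pdN d α (u A) x * pdN d β' (u A) x) = 0 ∧
      (fun β' => pdN d β' (u A) x) ≠ 0)
    -- (ii) the null dust transport equation
    (htrans : ∀ A, ∀ x ∈ U,
      2 * (∑ α, ∑ β', (g x)⁻¹ α β' * pdN d β' (u A) x * pdN d α (F A) x)
        + boxN d g (u A) x * F A x = 0) :
    ∀ a : (Fin (d + 1) → ℝ) → (Fin (d + 1) → ℝ) → ℝ,
      ContDiff ℝ (⊤ : ℕ∞) (fun p : (Fin (d + 1) → ℝ) × (Fin (d + 1) → ℝ) => a p.1 p.2) →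
      HasCompactSupport (fun p : (Fin (d + 1) → ℝ) × (Fin (d + 1) → ℝ) => a p.1 p.2) →
      (∀ x ξ, a x ξ ≠ 0 → x ∈ U) →
      (∑ A : ι, ∫ x in U,
        ((∑ α, ∑ β', (g x)⁻¹ α β' * pdN d β' (u A) x
            * pdN d α (fun y => a y (fun μ => pdN d μ (u A) x)) x)
          - (1 / 2) * ∑ σ, ∑ α, ∑ β',
              pdN d σ (fun y => (g y)⁻¹ α β') x * pdN d α (u A) x * pdN d β' (u A) x
                * pdN d σ (fun ξ => a x ξ) (fun μ => pdN d μ (u A) x))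
        * (F A x) ^ 2 * Real.sqrt (-(g x).det)) = 0 := by
  intro a ha _ _
  refine Finset.sum_eq_zero fun A _ => ?_
  have hdet0 : ∀ x ∈ U, (g x).det ≠ 0 := fun x hx => (hgdet x hx).ne
  have hG : ∀ α β, ContDiffOn ℝ 2 (fun x => (g x)⁻¹ α β) U := contDiffOn_matrix_inv hgC2 hdet0
  have hw : ContDiffOn ℝ 2 (fun x => Real.sqrt (-(g x).det)) U :=
    (contDiffOn_matrix_det hgC2).neg.sqrt fun x hx => neg_ne_zero.2 (hdet0 x hx)
  have hP : ∀ β, ContDiffOn ℝ 1 (pdN d β (u A)) U := fun β =>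
    (hureg A).pdN hU (by norm_num) β
  have h12 : (1 : WithTop ℕ∞) ≤ 2 := by norm_num
  have hVterm : ∀ α β, ContDiffOn ℝ 1
      (fun y => (g y)⁻¹ α β * Real.sqrt (-(g y).det) * pdN d β (u A) y) U := fun α β =>
    (((hG α β).of_le h12).mul (hw.of_le h12)).mul (hP β)
  set V : Fin (d + 1) → (Fin (d + 1) → ℝ) → ℝ := fun α y =>
    ∑ β, (g y)⁻¹ α β * Real.sqrt (-(g y).det) * pdN d β (u A) y with hVdef
  have hV : ∀ α, ContDiffOn ℝ 1 (V α) U := fun α => ContDiffOn.sum fun β _ => hVterm α β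
  set b : (Fin (d + 1) → ℝ) → ℝ := fun y => a y (fun μ => pdN d μ (u A) y)
  have ha1 : ContDiff ℝ 1 (fun p : (Fin (d + 1) → ℝ) × (Fin (d + 1) → ℝ) => a p.1 p.2) :=
    ha.of_le (by exact_mod_cast le_top)
  have hb : ContDiffOn ℝ 1 b U :=
    ha1.comp_contDiffOn (contDiffOn_id.prodMk (contDiffOn_pi.2 hP))
  have hdiff : ∀ {f : (Fin (d + 1) → ℝ) → ℝ}, ContDiffOn ℝ 1 f U → ∀ x ∈ U,
      DifferentiableAt ℝ f x := fun hf x hx =>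
    (hf.contDiffAt (hU.mem_nhds hx)).differentiableAt (by norm_num)
  rw [← setIntegral_divergence_eq_zero hU (hFsupp A).1 (hFsupp A).2
    (H := fun α y => b y * (F A y * F A y) * V α y)
    (fun α => (hb.mul ((hFreg A).mul (hFreg A))).mul (hV α))
    (fun α x hx => by simp [image_eq_zero_of_notMem_tsupport hx])]
  refine setIntegral_congr_fun hU.measurableSet fun x hx => ?_
  have hFd := hdiff (hFreg A) x hx
  have hbd := hdiff hb x hx
  have hGd : ∀ α β, DifferentiableAt ℝ (fun y => (g y)⁻¹ α β) x := fun α β =>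
    hdiff ((hG α β).of_le h12) x hx
  have hPd : ∀ β, DifferentiableAt ℝ (pdN d β (u A)) x := fun β => hdiff (hP β) x hx
  have hGsymm : ∀ α β, (g x)⁻¹ α β = (g x)⁻¹ β α := fun α β => (hgsymm x hx).inv.apply β α
  have hQ : ∀ α β, pdN d α (pdN d β (u A)) x = pdN d β (pdN d α (u A)) x :=
    pdN_comm ((hureg A).contDiffAt (hU.mem_nhds hx))
  have heik' : ∀ σ, ∑ α, ∑ β, (pdN d σ (fun y => (g y)⁻¹ α β) x * pdN d α (u A) x
      * pdN d β (u A) x + (g x)⁻¹ α β * pdN d σ (pdN d α (u A)) x * pdN d β (u A) x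
      + (g x)⁻¹ α β * pdN d α (u A) x * pdN d σ (pdN d β (u A)) x) = 0 := by
    intro σ
    have hz : pdN d σ (fun y => ∑ α, ∑ β, (g y)⁻¹ α β * pdN d α (u A) y * pdN d β (u A) y) x
        = 0 := by
      have : (fun y => ∑ α, ∑ β, (g y)⁻¹ α β * pdN d α (u A) y * pdN d β (u A) y)
          =ᶠ[nhds x] fun _ => 0 :=
        Filter.eventually_of_mem (hU.mem_nhds hx) fun y hy => (heik A y hy).1
      unfold pdN at this ⊢
      rw [this.fderiv_eq]
      simp
    have ht : ∀ α β, DifferentiableAt ℝ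
        (fun y => (g y)⁻¹ α β * pdN d α (u A) y * pdN d β (u A) y) x := fun α β =>
      ((hGd α β).mul (hPd α)).mul (hPd β)
    rw [← hz, pdN_sum _ _ fun α _ => DifferentiableAt.fun_sum fun β _ => ht α β]
    refine Finset.sum_congr rfl fun α _ => ?_
    rw [pdN_sum _ _ fun β _ => ht α β]
    refine Finset.sum_congr rfl fun β _ => ?_
    rw [pdN_mul σ ((hGd α β).fun_mul (hPd α)) (hPd β), pdN_mul σ (hGd α β) (hPd α)]
    ring
  have hchain : ∀ α, pdN d α b x = pdN d α (fun y => a y (fun μ => pdN d μ (u A) x)) x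
      + ∑ σ, pdN d σ (fun ξ => a x ξ) (fun μ => pdN d μ (u A) x)
        * pdN d α (pdN d σ (u A)) x := fun α =>
    pdN_comp_section (ha1.differentiable (by norm_num) _) hPd α
  have hflow := sum_transport_eq (fun α β => (g x)⁻¹ α β)
    (fun α β => pdN d α (pdN d β (u A)) x) (fun β => pdN d β (u A) x)
    (fun α => pdN d α (fun y => a y (fun μ => pdN d μ (u A) x)) x)
    (fun σ => pdN d σ (fun ξ => a x ξ) (fun μ => pdN d μ (u A) x))
    (fun σ α β => pdN d σ (fun y => (g y)⁻¹ α β) x) hGsymm hQ heik'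
  simp only [← hchain] at hflow
  have hpos : 0 < Real.sqrt (-(g x).det) := Real.sqrt_pos.2 (neg_pos.2 (hgdet x hx))
  have hVsum : ∀ c : Fin (d + 1) → ℝ, ∑ α, c α * V α x
      = Real.sqrt (-(g x).det) * ∑ α, ∑ β, (g x)⁻¹ α β * pdN d β (u A) x * c α := by
    intro c
    rw [Finset.mul_sum]
    refine Finset.sum_congr rfl fun α _ => ?_
    rw [hVdef, Finset.mul_sum, Finset.mul_sum]
    exact Finset.sum_congr rfl fun β _ => by ring
  have hbox : Real.sqrt (-(g x).det) * boxN d g (u A) x = ∑ α, pdN d α (V α) x := by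
    unfold boxN
    rw [mul_inv_cancel_left₀ hpos.ne']
  have hprod : ∀ α, pdN d α (fun y => b y * (F A y * F A y) * V α y) x
      = (F A x) ^ 2 * (pdN d α b x * V α x) + b x * F A x * (2 * (pdN d α (F A) x * V α x)
        + F A x * pdN d α (V α) x) := by
    intro α
    rw [pdN_mul α (hbd.fun_mul (hFd.fun_mul hFd)) (hdiff (hV α) x hx), pdN_mul α hbd (hFd.fun_mul hFd),
      pdN_mul α hFd hFd]
    ring
  have htr : 2 * ∑ α, pdN d α (F A) x * V α x + F A x * ∑ α, pdN d α (V α) x = 0 := by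
    rw [hVsum, ← hbox]
    linear_combination Real.sqrt (-(g x).det) * htrans A x hx
  simp only [hprod, Finset.sum_add_distrib, ← Finset.mul_sum]
  rw [htr, ← hflow, hVsum]
  ring

end
end

section
/- Let M=(0,T)×ℝ² and let g₀:M→{symmetric invertible 3×3 real matrices} be smooth with det g₀<0. Let p₀∈(8/3,∞) and set q₀=max{2, p₀/(p₀−2)}. Let φₙ^{(1)}, φₙ^{(2)} (n∈ℕ) and φ₀^{(1)}, φ₀^{(2)} be smooth real functions on M such that for every compact K⊂M and each i∈{1,2}: (1) ‖φₙ^{(i)}−φ₀^{(i)}‖_{L^{q₀}(K)}→0 as n→∞; (2) sup_n ‖∂φₙ^{(i)}‖_{L²(K)}<∞; (3) there exist C¹ vector fields ξₙ^{(i)}=(ξₙ^{(i)})^α∂_α and continuous functions ηₙ^{(i)} on M with □_{g₀}φₙ^{(i)} = ∂_α(ξₙ^{(i)})^α + ηₙ^{(i)}, such that ‖ξₙ^{(i)}‖_{L²(K)}→0 and sup_n ‖ηₙ^{(i)}‖_{L^{p₀/2}(K)}<∞ for every compact K⊂M. Then for every ϑ∈C_c^∞(M), ∫_M ϑ·(g₀⁻¹)^{αβ}(∂_αφₙ^{(1)})(∂_βφₙ^{(2)})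 dx → ∫_M ϑ·(g₀⁻¹)^{αβ}(∂_αφ₀^{(1)})(∂_βφ₀^{(2)}) dx, i.e. the null form g₀⁻¹(dφₙ^{(1)},dφₙ^{(2)}) converges to g₀⁻¹(dφ₀^{(1)},dφ₀^{(2)}) in the sense of distributions. -/
open MeasureTheory Real Filter
open scoped ENNReal

noncomputable section

abbrev E3 : Type := Fin 3 → ℝ

/-- Partial derivative in coordinate direction `α`. -/
noncomputable def pd (α : Fin 3) (f : E3 → ℝ) (x : E3) : ℝ :=
  fderiv ℝ f x (Pi.single α 1)

/-- Wave operator of a matrix-valued Lorentzian metric: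
`□_g φ = (−det g)^{−1/2} ∂_α ((g⁻¹)^{αβ}(−det g)^{1/2} ∂_β φ)`. -/
noncomputable def boxM (g : E3 → Matrix (Fin 3) (Fin 3) ℝ) (φ : E3 → ℝ) (x : E3) : ℝ :=
  (Real.sqrt (-(g x).det))⁻¹ *
    ∑ α, pd α (fun y => ∑ β', (g y)⁻¹ α β' * Real.sqrt (-(g y).det) * pd β' φ y) x

/-- Null form `g⁻¹(dφ, dψ) = (g⁻¹)^{αβ} ∂_α φ ∂_β ψ`. -/
noncomputable def nullFormM (g : E3 → Matrix (Fin 3) (Fin 3) ℝ) (φ ψ : E3 → ℝ) (x : E3) : ℝ :=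
  ∑ α, ∑ β', (g x)⁻¹ α β' * pd α φ x * pd β' ψ x

theorem ContDiffOn.continuousOn_pd {M : Set E3} (hM : IsOpen M) {f : E3 → ℝ}
    (hf : ContDiffOn ℝ 1 f M) (α : Fin 3) : ContinuousOn (pd α f) M :=
  (hf.continuousOn_fderiv_of_isOpen hM le_rfl).clm_apply continuousOn_const

theorem ContDiffOn.contDiffOn_pd {M : Set E3} (hM : IsOpen M) {f : E3 → ℝ}
    (hf : ContDiffOn ℝ (⊤ : ℕ∞) f M) (α : Fin 3) : ContDiffOn ℝ (⊤ : ℕ∞) (pd α f) M :=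
  (hf.fderiv_of_isOpen hM (by simp)).clm_apply contDiffOn_const

theorem pd_eq_zero_of_notMem {K : Set E3} (hK : IsClosed K) {f : E3 → ℝ}
    (h0 : ∀ x ∉ K, f x = 0) (α : Fin 3) {x : E3} (hx : x ∉ K) : pd α f x = 0 := by
  have h : f =ᶠ[nhds x] fun _ => 0 := by
    filter_upwards [hK.isOpen_compl.mem_nhds hx] with y hy using h0 y hy
  simp [pd, h.fderiv_eq]

theorem pd_mul {f g : E3 → ℝ} {x : E3} (hf : DifferentiableAt ℝ f x)
    (hg : DifferentiableAt ℝ g x) (α : Fin 3) :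
    pd α (fun y => f y * g y) x = pd α f x * g x + f x * pd α g x := by
  simp [pd, fderiv_fun_mul hf hg]; ring

theorem pd_sub {f g : E3 → ℝ} {x : E3} (hf : DifferentiableAt ℝ f x)
    (hg : DifferentiableAt ℝ g x) (α : Fin 3) :
    pd α (fun y => f y - g y) x = pd α f x - pd α g x := by
  simp [pd, fderiv_fun_sub hf hg]

theorem ContinuousOn.integrable_of_eq_zero_off {K : Set E3} (hK : IsCompact K) {f : E3 → ℝ}
    (hf : ContinuousOn f K) (h0 : ∀ x ∉ K, f x = 0) : Integrable f := by
  rw [← integrableOn_iff_integrable_of_support_subset (s := K)]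
  · exact hf.integrableOn_compact hK
  · intro x hx
    by_contra h
    exact hx (h0 x h)

/-- Integration by parts for a cutoff `χ` vanishing off a compact subset of `M`. -/
theorem integral_pd_mul_eq_neg {M K : Set E3} (hM : IsOpen M) (hK : IsCompact K) (hKM : K ⊆ M)
    {χ F : E3 → ℝ} (hχ : ContDiffOn ℝ 1 χ M) (h0 : ∀ x ∉ K, χ x = 0)
    (hF : ContDiffOn ℝ 1 F M) (α : Fin 3) :
    ∫ x, pd α χ x * F x = -∫ x, χ x * pd α F x := by
  have hχ0 := fun x (hx : x ∉ K) => pd_eq_zero_of_notMem hK.isClosed h0 α hx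
  have hts : tsupport χ ⊆ K := closure_minimal
    (fun x hx => by by_contra h; exact hx (h0 x h)) hK.isClosed
  rw [eq_neg_iff_add_eq_zero, add_comm, ← eq_neg_iff_add_eq_zero]
  refine integral_mul_fderiv_eq_neg_fderiv_mul_of_integrable (f := χ) (g := F)
    (v := Pi.single α 1) ?_ ?_ ?_ ?_ ?_
  · exact ContinuousOn.integrable_of_eq_zero_off hK
      (((hχ.continuousOn_pd hM α).mul hF.continuousOn).mono hKM)
      fun x hx => mul_eq_zero_of_left (hχ0 x hx) _
  · exact ContinuousOn.integrable_of_eq_zero_off hK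
      ((hχ.continuousOn.mul (hF.continuousOn_pd hM α)).mono hKM) fun x hx => by simp [h0 x hx]
  · exact ContinuousOn.integrable_of_eq_zero_off hK
      ((hχ.continuousOn.mul hF.continuousOn).mono hKM) fun x hx => by simp [h0 x hx]
  · intro x _
    by_cases hx : x ∈ M
    · exact (hχ.differentiableOn one_ne_zero).differentiableAt (hM.mem_nhds hx)
    · have h : χ =ᶠ[nhds x] fun _ => 0 := by
        filter_upwards [hK.isClosed.isOpen_compl.mem_nhds fun h => hx (hKM h)] with y hy
          using h0 y hy
      exact h.differentiableAt_iff.2 (differentiableAt_const _)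
  · exact fun x hx =>
      (hF.differentiableOn one_ne_zero).differentiableAt (hM.mem_nhds (hKM (hts hx)))

/-- A weak-strong product, localized to a compact set, converges to zero. -/
theorem tendsto_integral_mul_mul_zero {K : Set E3} (hK : IsCompact K) {p q : ℝ≥0∞}
    [ENNReal.HolderConjugate p q] {c : E3 → ℝ} (hc : ContinuousOn c K) (h0 : ∀ x ∉ K, c x = 0)
    {f h : ℕ → E3 → ℝ} (hf : ∀ n, ContinuousOn (f n) K) (hh : ∀ n, ContinuousOn (h n) K)
    (hf0 : Tendsto (fun n => eLpNorm (f n) p (volume.restrict K)) atTop (nhds 0))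
    (hb : ∃ C : ℝ, ∀ᶠ n in atTop, eLpNorm (h n) q (volume.restrict K) ≤ ENNReal.ofReal C) :
    Tendsto (fun n => ∫ x, c x * f n x * h n x) atTop (nhds 0) := by
  obtain ⟨C, hC⟩ := hb
  obtain ⟨B, hB⟩ := hK.exists_bound_of_continuousOn hc
  have meas {k : E3 → ℝ} (hk : ContinuousOn k K) : AEStronglyMeasurable k (volume.restrict K) :=
    hk.aestronglyMeasurable_of_isCompact hK hK.measurableSet
  have hlim : Tendsto (fun n => ENNReal.ofReal B * eLpNorm (f n) p (volume.restrict K) *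
      ENNReal.ofReal C) atTop (nhds 0) := by
    have := ENNReal.Tendsto.mul_const (b := ENNReal.ofReal C)
      (ENNReal.Tendsto.const_mul (a := ENNReal.ofReal B) hf0 (Or.inr ENNReal.ofReal_ne_top))
      (Or.inr ENNReal.ofReal_ne_top)
    simpa using this
  rw [tendsto_zero_iff_enorm_tendsto_zero]
  refine tendsto_of_tendsto_of_tendsto_of_le_of_le' tendsto_const_nhds hlim
    (Eventually.of_forall fun _ => zero_le) ?_
  filter_upwards [hC] with n hn
  rw [← setIntegral_eq_integral_of_forall_compl_eq_zero (s := K) fun x hx => by simp [h0 x hx]]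
  calc ‖∫ x in K, c x * f n x * h n x‖ₑ
      ≤ ∫⁻ x in K, ‖c x * f n x * h n x‖ₑ := enorm_integral_le_lintegral_enorm _
    _ = eLpNorm ((fun x => c x * f n x) • h n) 1 (volume.restrict K) := by
        rw [eLpNorm_one_eq_lintegral_enorm]; rfl
    _ ≤ eLpNorm (fun x => c x * f n x) p (volume.restrict K) *
          eLpNorm (h n) q (volume.restrict K) :=
        eLpNorm_smul_le_mul_eLpNorm (meas (hh n)) (meas (hc.mul (hf n)))
    _ ≤ _ := by
        gcongr
        refine eLpNorm_le_mul_eLpNorm_of_ae_le_mul ?_ p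
        filter_upwards [ae_restrict_mem hK.measurableSet] with x hx
        rw [norm_mul]
        exact mul_le_mul_of_nonneg_right (hB x hx) (norm_nonneg _)

/-- Integrating the null form by parts moves every derivative of `u` off the wave operator
of `φ`, whose divergence part `ξ` is integrated by parts a second time. -/
theorem integral_mul_nullForm_eq {M K : Set E3} (hM : IsOpen M) (hK : IsCompact K) (hKM : K ⊆ M)
    {g : E3 → Matrix (Fin 3) (Fin 3) ℝ}
    (ha : ∀ α β, ContDiffOn ℝ (⊤ : ℕ∞) (fun x => (g x)⁻¹ α β) M)
    (hW : ContDiffOn ℝ (⊤ : ℕ∞) (fun x => Real.sqrt (-(g x).det)) M)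
    (hW0 : ∀ x ∈ M, Real.sqrt (-(g x).det) ≠ 0)
    {θ : E3 → ℝ} (hθ : ContDiffOn ℝ (⊤ : ℕ∞) θ M) (hθ0 : ∀ x ∉ K, θ x = 0)
    {u φ η : E3 → ℝ} {ξ : Fin 3 → E3 → ℝ} (hu : ContDiffOn ℝ (⊤ : ℕ∞) u M)
    (hφ : ContDiffOn ℝ (⊤ : ℕ∞) φ M) (hξ : ∀ α, ContDiffOn ℝ 1 (ξ α) M)
    (hη : ContinuousOn η M) (hbox : ∀ x ∈ M, boxM g φ x = (∑ α, pd α (ξ α) x) + η x) :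
    ∫ x, θ x * nullFormM g u φ x =
      (∑ α, ∫ x, pd α (fun y => θ y * u y) x * ξ α x) - (∫ x, θ x * u x * η x) -
      ∑ α, ∑ β, ∫ x, pd α (fun y => θ y * (Real.sqrt (-(g y).det))⁻¹) x *
        ((g x)⁻¹ α β * Real.sqrt (-(g x).det)) * u x * pd β φ x := by
  set W : E3 → ℝ := fun x => Real.sqrt (-(g x).det) with hWdef
  set F : Fin 3 → E3 → ℝ := fun α y => ∑ β, (g y)⁻¹ α β * W y * pd β φ y with hFdef
  have hF (α) : ContDiffOn ℝ (⊤ : ℕ∞) (F α) M :=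
    ContDiffOn.sum fun β _ => ((ha α β).mul hW).mul (hφ.contDiffOn_pd hM β)
  have hle : (1 : WithTop ℕ∞) ≤ ((⊤ : ℕ∞) : WithTop ℕ∞) := by simp
  set ρ : E3 → ℝ := fun y => θ y * (W y)⁻¹ with hρdef
  have hρ : ContDiffOn ℝ (⊤ : ℕ∞) ρ M := hθ.mul (hW.inv hW0)
  have hρ0 : ∀ x ∉ K, ρ x = 0 := fun x hx => by simp [hρdef, hθ0 x hx]
  have hθu := hθ.mul hu
  have hρu := hρ.mul hu
  have diff {f : E3 → ℝ} (hf : ContDiffOn ℝ (⊤ : ℕ∞) f M) {x : E3} (hx : x ∈ M) :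
      DifferentiableAt ℝ f x := (hf.differentiableOn (by simp)).differentiableAt (hM.mem_nhds hx)
  have integ {f : E3 → ℝ} (hf : ContinuousOn f M) (h0 : ∀ x ∉ K, f x = 0) : Integrable f :=
    (hf.mono hKM).integrable_of_eq_zero_off hK h0
  have key (x : E3) : θ x * nullFormM g u φ x =
      (∑ α, pd α (fun y => ρ y * u y) x * F α x) -
      ∑ α, ∑ β, pd α ρ x * ((g x)⁻¹ α β * W x) * u x * pd β φ x := by
    by_cases hx : x ∈ K
    · have hWx : W x ≠ 0 := hW0 x (hKM hx)
      rw [← Finset.sum_sub_distrib, nullFormM, Finset.mul_sum]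
      refine Finset.sum_congr rfl fun α _ => ?_
      rw [pd_mul (diff hρ (hKM hx)) (diff hu (hKM hx)), hFdef, Finset.mul_sum, Finset.mul_sum,
        ← Finset.sum_sub_distrib]
      refine Finset.sum_congr rfl fun β _ => ?_
      simp only [hρdef]
      field_simp
      ring
    · simp [hθ0 x hx, pd_eq_zero_of_notMem hK.isClosed hρ0 _ hx,
        pd_eq_zero_of_notMem (f := fun y => ρ y * u y) hK.isClosed
          (fun y hy => by simp [hρ0 y hy]) _ hx]
  have hT1 (α) : Integrable fun x => pd α (fun y => ρ y * u y) x * F α x :=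
    integ ((hρu.contDiffOn_pd hM α).continuousOn.mul (hF α).continuousOn) fun x hx => by
      simp [pd_eq_zero_of_notMem (f := fun y => ρ y * u y) hK.isClosed
          (fun y hy => by simp [hρ0 y hy]) _ hx]
  have hT2 (α β) : Integrable fun x => pd α ρ x * ((g x)⁻¹ α β * W x) * u x * pd β φ x :=
    integ ((((hρ.contDiffOn_pd hM α).mul ((ha α β).mul hW)).mul hu).mul (hφ.contDiffOn_pd hM β)).continuousOn
      fun x hx => by simp [pd_eq_zero_of_notMem hK.isClosed hρ0 _ hx]
  have hT3 (α) : Integrable fun x => ρ x * u x * pd α (F α) x :=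
    integ (hρu.continuousOn.mul ((hF α).contDiffOn_pd hM α).continuousOn) fun x hx => by simp [hρ0 x hx]
  have hT4 (α) : Integrable fun x => θ x * u x * pd α (ξ α) x :=
    integ (hθu.continuousOn.mul ((hξ α).continuousOn_pd hM α)) fun x hx => by simp [hθ0 x hx]
  have hT5 : Integrable fun x => θ x * u x * η x :=
    integ (hθu.continuousOn.mul hη) fun x hx => by simp [hθ0 x hx]
  have hdiv : ∑ α, ∫ x, pd α (fun y => ρ y * u y) x * F α x =
      (∑ α, ∫ x, pd α (fun y => θ y * u y) x * ξ α x) - ∫ x, θ x * u x * η x := by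
    have e1 (α) := integral_pd_mul_eq_neg hM hK hKM (χ := fun y => ρ y * u y) (hρu.of_le hle)
      (fun y hy => by simp [hρ0 y hy]) ((hF α).of_le hle) α
    have e2 (α) := integral_pd_mul_eq_neg hM hK hKM (χ := fun y => θ y * u y) (hθu.of_le hle)
      (fun y hy => by simp [hθ0 y hy]) (hξ α) α
    simp only [e1, e2, Finset.sum_neg_distrib]
    rw [← integral_finsetSum _ fun α _ => hT3 α, ← integral_finsetSum _ fun α _ => hT4 α,
      ← neg_add', ← integral_add (integrable_finsetSum _ fun α _ => hT4 α) hT5]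
    congr 2 with x
    by_cases hx : x ∈ K
    · rw [← Finset.mul_sum, ← Finset.mul_sum, ← mul_add, ← hbox x (hKM hx)]
      simp only [boxM, hρdef, hFdef, hWdef]
      ring
    · simp [hρ0 x hx, hθ0 x hx]
  simp only [key]
  rw [integral_sub (integrable_finsetSum _ fun α _ => hT1 α)
    (integrable_finsetSum _ fun α _ => integrable_finsetSum _ fun β _ => hT2 α β),
    integral_finsetSum _ fun α _ => hT1 α, hdiv,
    integral_finsetSum _ fun α _ => integrable_finsetSum _ fun β _ => hT2 α β]
  congr 1
  exact Finset.sum_congr rfl fun α _ => integral_finsetSum _ fun β _ => hT2 α β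

theorem integral_mul_nullForm_eq_neg {M K : Set E3} (hM : IsOpen M) (hK : IsCompact K)
    (hKM : K ⊆ M) {g : E3 → Matrix (Fin 3) (Fin 3) ℝ}
    (ha : ∀ α β, ContDiffOn ℝ (⊤ : ℕ∞) (fun x => (g x)⁻¹ α β) M)
    {θ : E3 → ℝ} (hθ : ContDiffOn ℝ (⊤ : ℕ∞) θ M) (hθ0 : ∀ x ∉ K, θ x = 0)
    {ψ v : E3 → ℝ} (hψ : ContDiffOn ℝ (⊤ : ℕ∞) ψ M) (hv : ContDiffOn ℝ (⊤ : ℕ∞) v M) :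
    ∫ x, θ x * nullFormM g ψ v x =
      -∑ α, ∑ β, ∫ x, pd β (fun y => θ y * (g y)⁻¹ α β * pd α ψ y) x * v x := by
  have hle : (1 : WithTop ℕ∞) ≤ ((⊤ : ℕ∞) : WithTop ℕ∞) := by simp
  have hχ (α β) : ContDiffOn ℝ (⊤ : ℕ∞) (fun y => θ y * (g y)⁻¹ α β * pd α ψ y) M :=
    (hθ.mul (ha α β)).mul (hψ.contDiffOn_pd hM α)
  have hint (α β) : Integrable fun x => θ x * (g x)⁻¹ α β * pd α ψ x * pd β v x :=
    (((hχ α β).mul (hv.contDiffOn_pd hM β)).continuousOn.mono hKM).integrable_of_eq_zero_off hK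
      fun x hx => by simp [hθ0 x hx]
  have e (α β) := integral_pd_mul_eq_neg hM hK hKM ((hχ α β).of_le hle)
    (fun x hx => by simp [hθ0 x hx]) (hv.of_le hle) β
  simp only [e, Finset.sum_neg_distrib, neg_neg]
  have hsum (x : E3) : θ x * nullFormM g ψ v x =
      ∑ α, ∑ β, θ x * (g x)⁻¹ α β * pd α ψ x * pd β v x := by
    simp only [nullFormM, Finset.mul_sum, mul_assoc]
  simp only [hsum]
  rw [integral_finsetSum _ fun α _ => integrable_finsetSum _ fun β _ => hint α β]
  exact Finset.sum_congr rfl fun α _ => integral_finsetSum _ fun β _ => hint α β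

theorem integrable_mul_nullForm {M K : Set E3} (hM : IsOpen M) (hK : IsCompact K)
    (hKM : K ⊆ M) {g : E3 → Matrix (Fin 3) (Fin 3) ℝ}
    (ha : ∀ α β, ContDiffOn ℝ (⊤ : ℕ∞) (fun x => (g x)⁻¹ α β) M)
    {θ : E3 → ℝ} (hθ : ContDiffOn ℝ (⊤ : ℕ∞) θ M) (hθ0 : ∀ x ∉ K, θ x = 0)
    {ψ v : E3 → ℝ} (hψ : ContDiffOn ℝ (⊤ : ℕ∞) ψ M) (hv : ContDiffOn ℝ (⊤ : ℕ∞) v M) :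
    Integrable fun x => θ x * nullFormM g ψ v x := by
  refine ContinuousOn.integrable_of_eq_zero_off hK ?_ fun x hx => by simp [hθ0 x hx]
  refine ContinuousOn.mono (ContDiffOn.continuousOn (𝕜 := ℝ) (n := (⊤ : ℕ∞)) ?_) hKM
  exact hθ.mul (ContDiffOn.sum fun α _ => ContDiffOn.sum fun β _ =>
    ((ha α β).mul (hψ.contDiffOn_pd hM α)).mul (hv.contDiffOn_pd hM β))

theorem contDiffOn_det {M : Set E3} {g : E3 → Matrix (Fin 3) (Fin 3) ℝ}
    (hg : ∀ α β, ContDiffOn ℝ (⊤ : ℕ∞) (fun x => g x α β) M) :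
    ContDiffOn ℝ (⊤ : ℕ∞) (fun x => (g x).det) M := by
  simp only [Matrix.det_apply']
  exact ContDiffOn.sum fun σ _ => contDiffOn_const.mul (contDiffOn_prod fun i _ => hg _ _)

theorem contDiffOn_inv_apply {M : Set E3} {g : E3 → Matrix (Fin 3) (Fin 3) ℝ}
    (hg : ∀ α β, ContDiffOn ℝ (⊤ : ℕ∞) (fun x => g x α β) M) (hdet : ∀ x ∈ M, (g x).det ≠ 0)
    (α β : Fin 3) : ContDiffOn ℝ (⊤ : ℕ∞) (fun x => (g x)⁻¹ α β) M := by
  simp only [Matrix.inv_def, Matrix.smul_apply, smul_eq_mul, Ring.inverse_eq_inv',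
    Matrix.adjugate_apply]
  refine ((contDiffOn_det hg).inv hdet).mul (contDiffOn_det fun i j => ?_)
  by_cases h : i = β
  · simpa [Matrix.updateRow_apply, h] using contDiffOn_const
  · simpa [Matrix.updateRow_apply, h] using hg i j

/-- Lemma `lem:limitwave` of Huneau–Luk, bilinear compensated compactness for
null forms: under strong `L^{q₀}` convergence of the functions, uniform `L²` bounds on the
gradients, and an `L² + L^{p₀/2}` decomposition of the wave operators, the null form
`g₀⁻¹(dφₙ^{(1)}, dφₙ^{(2)})` converges to `g₀⁻¹(dφ₀^{(1)}, dφ₀^{(2)})` as distributions. -/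
theorem stmt4
    (T p₀ q₀ : ℝ) (hT : 0 < T) (hp₀ : 8 / 3 < p₀)
    (hq₀ : q₀ = max 2 (p₀ / (p₀ - 2)))
    (Mset : Set E3) (hM : Mset = {x : E3 | x 0 ∈ Set.Ioo 0 T})
    (g₀ : E3 → Matrix (Fin 3) (Fin 3) ℝ)
    (hg₀ : ∀ α β', ContDiffOn ℝ (⊤ : ℕ∞) (fun x => g₀ x α β') Mset)
    (hgsymm : ∀ x ∈ Mset, (g₀ x).IsSymm)
    (hgdet : ∀ x ∈ Mset, (g₀ x).det < 0)
    (φ : Fin 2 → ℕ → E3 → ℝ) (φlim : Fin 2 → E3 → ℝ)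
    (hφreg : ∀ i n, ContDiffOn ℝ (⊤ : ℕ∞) (φ i n) Mset)
    (hφlimreg : ∀ i, ContDiffOn ℝ (⊤ : ℕ∞) (φlim i) Mset)
    -- (1) strong L^{q₀} convergence on compact sets
    (hconv : ∀ K ⊆ Mset, IsCompact K → ∀ i,
      Tendsto (fun n => eLpNorm (fun x => φ i n x - φlim i x)
        (ENNReal.ofReal q₀) (volume.restrict K)) atTop (nhds 0))
    -- (2) uniform L² bounds on gradients
    (hgrad : ∀ K ⊆ Mset, IsCompact K → ∃ C : ℝ, ∀ i n, ∀ α : Fin 3,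
      eLpNorm (pd α (φ i n)) 2 (volume.restrict K) ≤ ENNReal.ofReal C)
    -- (3) decomposition of the wave operator
    (hdecomp : ∀ i, ∃ ξv : ℕ → Fin 3 → E3 → ℝ, ∃ η : ℕ → E3 → ℝ,
      (∀ n α, ContDiffOn ℝ 1 (ξv n α) Mset) ∧ (∀ n, ContinuousOn (η n) Mset) ∧
      (∀ n, ∀ x ∈ Mset, boxM g₀ (φ i n) x = (∑ α, pd α (ξv n α) x) + η n x) ∧
      (∀ K ⊆ Mset, IsCompact K →
        (∀ α, Tendsto (fun n => eLpNorm (ξv n α) 2 (volume.restrict K)) atTop (nhds 0)) ∧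
        (∃ C : ℝ, ∀ n,
          eLpNorm (η n) (ENNReal.ofReal (p₀ / 2)) (volume.restrict K) ≤ ENNReal.ofReal C))) :
    ∀ ϑ : E3 → ℝ, ContDiff ℝ (⊤ : ℕ∞) ϑ → HasCompactSupport ϑ → tsupport ϑ ⊆ Mset →
      Tendsto (fun n => ∫ x, ϑ x * nullFormM g₀ (φ 0 n) (φ 1 n) x) atTop
        (nhds (∫ x, ϑ x * nullFormM g₀ (φlim 0) (φlim 1) x)) := by
  subst hM
  set M : Set E3 := {x : E3 | x 0 ∈ Set.Ioo 0 T}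
  intro θ hθ hθc hKM
  have hM : IsOpen M := isOpen_Ioo.preimage (continuous_apply 0)
  set K : Set E3 := tsupport θ
  have hK : IsCompact K := hθc
  have hθ0 : ∀ x ∉ K, θ x = 0 := fun x hx => image_eq_zero_of_notMem_tsupport hx
  have hθM : ContDiffOn ℝ (⊤ : ℕ∞) θ M := hθ.contDiffOn
  have ha := contDiffOn_inv_apply hg₀ fun x hx => (hgdet x hx).ne
  have hW0 : ∀ x ∈ M, Real.sqrt (-(g₀ x).det) ≠ 0 := fun x hx =>
    (Real.sqrt_pos.2 (neg_pos.2 (hgdet x hx))).ne'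
  have hW : ContDiffOn ℝ (⊤ : ℕ∞) (fun x => Real.sqrt (-(g₀ x).det)) M :=
    (contDiffOn_det hg₀).neg.sqrt fun x hx => neg_ne_zero.2 (hgdet x hx).ne
  have diff {f : E3 → ℝ} (hf : ContDiffOn ℝ (⊤ : ℕ∞) f M) {x : E3} (hx : x ∈ M) :
      DifferentiableAt ℝ f x := (hf.differentiableOn (by simp)).differentiableAt (hM.mem_nhds hx)
  have contK {f : E3 → ℝ} (hf : ContDiffOn ℝ (⊤ : ℕ∞) f M) : ContinuousOn f K :=
    hf.continuousOn.mono hKM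
  have : IsFiniteMeasure (volume.restrict K) := ⟨by simpa using hK.measure_lt_top⟩
  set w : Fin 2 → ℕ → E3 → ℝ := fun i n x => φ i n x - φlim i x with hwdef
  have hw (i n) : ContDiffOn ℝ (⊤ : ℕ∞) (w i n) M := (hφreg i n).sub (hφlimreg i)
  -- `w` tends to zero in every Lebesgue space of exponent at most `q₀`
  have hwp {p : ℝ≥0∞} (hp : p ≤ ENNReal.ofReal q₀) (i) :
      Tendsto (fun n => eLpNorm (w i n) p (volume.restrict K)) atTop (nhds 0) := by
    have hp' : 0 ≤ 1 / p.toReal - 1 / (ENNReal.ofReal q₀).toReal ∨ p = 0 := by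
      rcases eq_or_ne p 0 with h | h
      · exact Or.inr h
      · left
        have h1 := ENNReal.toReal_mono ENNReal.ofReal_ne_top hp
        have h2 := ENNReal.toReal_pos h (ne_top_of_le_ne_top ENNReal.ofReal_ne_top hp)
        exact sub_nonneg.2 (one_div_le_one_div_of_le h2 h1)
    rcases hp' with hp' | rfl
    · have hfin : volume.restrict K Set.univ ^
          (1 / p.toReal - 1 / (ENNReal.ofReal q₀).toReal) ≠ ⊤ :=
        ENNReal.rpow_ne_top_of_nonneg hp' (measure_ne_top _ _)
      have h := ENNReal.Tendsto.mul_const (hconv K hKM hK i) (Or.inr hfin)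
      rw [zero_mul] at h
      exact tendsto_of_tendsto_of_tendsto_of_le_of_le tendsto_const_nhds h (fun _ => zero_le)
        fun n => eLpNorm_le_eLpNorm_mul_rpow_measure_univ hp
          ((contK (hw i n)).aestronglyMeasurable_of_isCompact hK hK.measurableSet)
    · simp
  have hw2 (i) := hwp (p := 2) (by
    rw [hq₀, ← ENNReal.ofReal_ofNat]; exact ENNReal.ofReal_le_ofReal (le_max_left _ _)) i
  have hwq (i) := hwp (p := ENNReal.ofReal (p₀ / (p₀ - 2))) (by
    rw [hq₀]; exact ENNReal.ofReal_le_ofReal (le_max_right _ _)) i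
  have hconj : ENNReal.HolderConjugate (ENNReal.ofReal (p₀ / (p₀ - 2)))
      (ENNReal.ofReal (p₀ / 2)) := by
    refine Real.HolderConjugate.ennrealOfReal ?_
    rw [Real.holderConjugate_iff]
    refine ⟨by rw [lt_div_iff₀] <;> linarith, ?_⟩
    have : p₀ - 2 ≠ 0 := by linarith
    have : p₀ ≠ 0 := by linarith
    field_simp
    ring
  obtain ⟨C, hC⟩ := hgrad K hKM hK
  obtain ⟨ξ, η, hξ, hη, hbox, hξη⟩ := hdecomp 1
  obtain ⟨hξ0, C', hC'⟩ := hξη K hKM hK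
  -- the gradient of `w` is bounded in `L²`
  have hgw (i α) : ∃ B : ℝ, ∀ᶠ n in atTop,
      eLpNorm (pd α (w i n)) 2 (volume.restrict K) ≤ ENNReal.ofReal B := by
    have hl := contK ((hφlimreg i).contDiffOn_pd hM α)
    have hlim : eLpNorm (pd α (φlim i)) 2 (volume.restrict K) ≠ ⊤ := by
      obtain ⟨B, hB⟩ := hK.exists_bound_of_continuousOn hl
      refine (MemLp.of_bound (hl.aestronglyMeasurable_of_isCompact hK hK.measurableSet) B
        ?_).2.ne
      filter_upwards [ae_restrict_mem hK.measurableSet] with x hx using hB x hx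
    refine ⟨(ENNReal.ofReal C + eLpNorm (pd α (φlim i)) 2 (volume.restrict K)).toReal,
      Eventually.of_forall fun n => ?_⟩
    rw [ENNReal.ofReal_toReal (ENNReal.add_ne_top.2 ⟨ENNReal.ofReal_ne_top, hlim⟩)]
    calc eLpNorm (pd α (w i n)) 2 (volume.restrict K)
        = eLpNorm (pd α (φ i n) - pd α (φlim i)) 2 (volume.restrict K) := by
          refine eLpNorm_congr_ae ?_
          filter_upwards [ae_restrict_mem hK.measurableSet] with x hx
          exact pd_sub (diff (hφreg i n) (hKM hx)) (diff (hφlimreg i) (hKM hx)) α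
      _ ≤ _ := eLpNorm_sub_le
          ((contK ((hφreg i n).contDiffOn_pd hM α)).aestronglyMeasurable_of_isCompact hK
            hK.measurableSet)
          (hl.aestronglyMeasurable_of_isCompact hK hK.measurableSet) (by norm_num)
      _ ≤ _ := by gcongr; exact hC i n α
  have hpd0 {f : E3 → ℝ} (h : ∀ x ∉ K, f x = 0) (α) : ∀ x ∉ K, pd α f x = 0 :=
    fun x hx => pd_eq_zero_of_notMem hK.isClosed h α hx
  have hθK : ContinuousOn θ K := contK hθM
  have hξK (n α) : ContinuousOn (ξ n α) K := (hξ n α).continuousOn.mono hKM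
  have hwK (i n) : ContinuousOn (w i n) K := contK (hw i n)
  have hdwK (i n α) : ContinuousOn (pd α (w i n)) K := contK ((hw i n).contDiffOn_pd hM α)
  -- the quadratic part
  have hquad : Tendsto (fun n => ∫ x, θ x * nullFormM g₀ (w 0 n) (φ 1 n) x) atTop (nhds 0) := by
    have hA (α) : Tendsto (fun n => ∫ x, pd α (fun y => θ y * w 0 n y) x * ξ n α x) atTop
        (nhds 0) := by
      have h1 := tendsto_integral_mul_mul_zero hK (p := 2) (q := 2) hθK hθ0
        (fun n => hξK n α) (fun n => hdwK 0 n α) (hξ0 α) (hgw 0 α)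
      have hbdd : ∃ B : ℝ, ∀ᶠ n in atTop,
          eLpNorm (w 0 n) 2 (volume.restrict K) ≤ ENNReal.ofReal B :=
        ⟨1, ((hw2 0).eventually (ge_mem_nhds (by simp)))⟩
      have hdθ := contK (hθM.contDiffOn_pd hM α)
      have h2 := tendsto_integral_mul_mul_zero hK (p := 2) (q := 2) hdθ (hpd0 hθ0 α)
        (fun n => hξK n α) (fun n => hwK 0 n) (hξ0 α) hbdd
      have h := h1.add h2
      rw [add_zero] at h
      refine h.congr fun n => ?_
      rw [← integral_add]
      · congr 1 with x
        by_cases hx : x ∈ K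
        · rw [pd_mul (diff hθM (hKM hx)) (diff (hw 0 n) (hKM hx))]
          ring
        · rw [hθ0 x hx, hpd0 hθ0 α x hx,
            hpd0 (f := fun y => θ y * w 0 n y) (fun y hy => by simp [hθ0 y hy]) α x hx]
          ring
      · exact ((hθK.mul (hξK n α)).mul (hdwK 0 n α)).integrable_of_eq_zero_off hK
          fun x hx => by simp [hθ0 x hx]
      · exact ((hdθ.mul (hξK n α)).mul (hwK 0 n)).integrable_of_eq_zero_off hK
          fun x hx => by simp [hpd0 hθ0 α x hx]
    have hB : Tendsto (fun n => ∫ x, θ x * w 0 n x * η n x) atTop (nhds 0) :=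
      tendsto_integral_mul_mul_zero hK hθK hθ0 (hwK 0) (fun n => (hη n).mono hKM) (hwq 0)
        ⟨C', Eventually.of_forall hC'⟩
    have hρ0 : ∀ x ∉ K, θ x * (Real.sqrt (-(g₀ x).det))⁻¹ = 0 := fun x hx => by simp [hθ0 x hx]
    have hD (α β) : Tendsto (fun n => ∫ x, pd α (fun y => θ y * (Real.sqrt (-(g₀ y).det))⁻¹) x *
        ((g₀ x)⁻¹ α β * Real.sqrt (-(g₀ x).det)) * w 0 n x * pd β (φ 1 n) x) atTop (nhds 0) :=
      tendsto_integral_mul_mul_zero hK (p := 2) (q := 2)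
        (contK (((hθM.mul (hW.inv hW0)).contDiffOn_pd hM α).mul ((ha α β).mul hW)))
        (fun x hx => by simp [hpd0 hρ0 α x hx]) (hwK 0)
        (fun n => contK ((hφreg 1 n).contDiffOn_pd hM β)) (hw2 0)
        ⟨C, Eventually.of_forall fun n => hC 1 n β⟩
    have h := ((tendsto_finsetSum Finset.univ fun α _ => hA α).sub hB).sub
      (tendsto_finsetSum Finset.univ fun α _ => tendsto_finsetSum Finset.univ fun β _ => hD α β)
    simp only [Finset.sum_const_zero, sub_zero] at h
    exact h.congr fun n => (integral_mul_nullForm_eq hM hK hKM ha hW hW0 hθM hθ0 (hw 0 n)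
      (hφreg 1 n) (hξ n) (hη n) (hbox n)).symm
  -- the linear part
  have hlin : Tendsto (fun n => ∫ x, θ x * nullFormM g₀ (φlim 0) (w 1 n) x) atTop (nhds 0) := by
    have hE (α β) : Tendsto (fun n => ∫ x,
        pd β (fun y => θ y * (g₀ y)⁻¹ α β * pd α (φlim 0) y) x * w 1 n x) atTop (nhds 0) := by
      have h := tendsto_integral_mul_mul_zero hK (p := 2) (q := 2)
        (contK (((hθM.mul (ha α β)).mul ((hφlimreg 0).contDiffOn_pd hM α)).contDiffOn_pd hM β))
        (hpd0 (fun x hx => by simp [hθ0 x hx]) β) (hwK 1)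
        (h := fun _ _ => 1) (fun n => continuousOn_const) (hw2 1)
        ⟨(eLpNorm (fun _ : E3 => (1 : ℝ)) 2 (volume.restrict K)).toReal,
          Eventually.of_forall fun n => (ENNReal.ofReal_toReal (memLp_const 1).2.ne).ge⟩
      simpa only [mul_one] using h
    have h := (tendsto_finsetSum Finset.univ fun α _ =>
      tendsto_finsetSum Finset.univ fun β _ => hE α β).neg
    simp only [Finset.sum_const_zero, neg_zero] at h
    exact h.congr fun n => (integral_mul_nullForm_eq_neg hM hK hKM ha hθM hθ0 (hφlimreg 0)
      (hw 1 n)).symm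
  have hall := (hquad.add hlin).add_const (∫ x, θ x * nullFormM g₀ (φlim 0) (φlim 1) x)
  rw [add_zero, zero_add] at hall
  refine hall.congr fun n => ?_
  have hq := integrable_mul_nullForm hM hK hKM ha hθM hθ0 (hw 0 n) (hφreg 1 n)
  have hl := integrable_mul_nullForm hM hK hKM ha hθM hθ0 (hφlimreg 0) (hw 1 n)
  have hql : Integrable fun x => θ x * nullFormM g₀ (w 0 n) (φ 1 n) x +
      θ x * nullFormM g₀ (φlim 0) (w 1 n) x := hq.add hl
  rw [← integral_add hq hl, ← integral_add hql
    (integrable_mul_nullForm hM hK hKM ha hθM hθ0 (hφlimreg 0) (hφlimreg 1))]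
  congr 1 with x
  by_cases hx : x ∈ K
  · simp only [nullFormM, hwdef, pd_sub (diff (hφreg 0 n) (hKM hx)) (diff (hφlimreg 0) (hKM hx)),
      pd_sub (diff (hφreg 1 n) (hKM hx)) (diff (hφlimreg 1) (hKM hx)), ← mul_add,
      ← Finset.sum_add_distrib]
    congr 1
    refine Finset.sum_congr rfl fun α _ => Finset.sum_congr rfl fun β _ => ?_
    ring
  · simp [hθ0 x hx]

end
end
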